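/- arXiv:1610.04388 — 5 statements merged into one kernel-verified Lean document; each statement's English description precedes it below -/
import Mathlib

section
/- Every satisfiable HyperLTL sentence has a countable model: if φ is a HyperLTL sentence and T ⊨ φ for some set of traces T, then there exists a countable set of traces S with S ⊨ φ. -/
/-- A trace over a set `AP` of atomic propositions: an infinite word over `2^AP`. -/
abbrev Trace (AP : Type) : Type := ℕ → Set AP

/-- Quantifier-free HyperLTL formulas over atomic propositions `AP`
and trace variables `V`: `ψ ::= a_π | ¬ψ | ψ∨ψ | Xψ | ψUψ`. -/
inductive QF (AP V : Type) : Type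
  | atom : AP → V → QF AP V
  | not  : QF AP V → QF AP V
  | or   : QF AP V → QF AP V → QF AP V
  | next : QF AP V → QF AP V
  | untl : QF AP V → QF AP V → QF AP V

/-- HyperLTL formulas in prenex form: `φ ::= ∃π.φ | ∀π.φ | ψ`. -/
inductive HyperLTL (AP V : Type) : Type
  | exi : V → HyperLTL AP V → HyperLTL AP V
  | all : V → HyperLTL AP V → HyperLTL AP V
  | qf  : QF AP V → HyperLTL AP V

/-- `Π[j,∞)`: shift every trace of the assignment forward by `j` positions. -/
def shiftAsgn {AP V : Type} (ρ : V → Trace AP) (j : ℕ) : V → Trace AP :=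
  fun v n => ρ v (n + j)

/-- Satisfaction of quantifier-free HyperLTL formulas w.r.t. a trace assignment. -/
def QF.sat {AP V : Type} (ρ : V → Trace AP) : QF AP V → Prop
  | atom a π => a ∈ ρ π 0
  | not ψ => ¬ ψ.sat ρ
  | or ψ₁ ψ₂ => ψ₁.sat ρ ∨ ψ₂.sat ρ
  | next ψ => ψ.sat (shiftAsgn ρ 1)
  | untl ψ₁ ψ₂ => ∃ j, ψ₂.sat (shiftAsgn ρ j) ∧ ∀ j' < j, ψ₁.sat (shiftAsgn ρ j')

/-- Satisfaction of HyperLTL formulas over a set `T` of traces and a trace assignment. -/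
def HyperLTL.sat {AP V : Type} [DecidableEq V] (T : Set (Trace AP)) (ρ : V → Trace AP) :
    HyperLTL AP V → Prop
  | exi π φ => ∃ t ∈ T, φ.sat T (Function.update ρ π t)
  | all π φ => ∀ t ∈ T, φ.sat T (Function.update ρ π t)
  | qf ψ => ψ.sat ρ

/-- Free trace variables of a quantifier-free formula. -/
def QF.free {AP V : Type} : QF AP V → Set V
  | atom _ π => {π}
  | not ψ => ψ.free
  | or ψ₁ ψ₂ => ψ₁.free ∪ ψ₂.free
  | next ψ => ψ.free
  | untl ψ₁ ψ₂ => ψ₁.free ∪ ψ₂.free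

/-- Free trace variables of a HyperLTL formula. -/
def HyperLTL.free {AP V : Type} : HyperLTL AP V → Set V
  | exi π φ => φ.free \ {π}
  | all π φ => φ.free \ {π}
  | qf ψ => ψ.free

/-- A HyperLTL sentence: a closed formula. -/
def HyperLTL.Closed {AP V : Type} (φ : HyperLTL AP V) : Prop := φ.free = ∅

/-- `T ⊨ φ` for a sentence `φ`: satisfaction w.r.t. the empty (here: trivial)
trace assignment, which is irrelevant for sentences. -/
def HyperLTL.Models {AP V : Type} [DecidableEq V] (T : Set (Trace AP))
    (φ : HyperLTL AP V) : Prop :=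
  φ.sat T (fun _ _ => ∅)

/-- Conjunction, as a derived operator. -/
def QF.and {AP V : Type} (ψ₁ ψ₂ : QF AP V) : QF AP V := .not (.or ψ₁.not ψ₂.not)

/-- Eventually: `F ψ = true U ψ` (with `true` built from `ψ`). -/
def QF.ev {AP V : Type} (ψ : QF AP V) : QF AP V := .untl (.or ψ ψ.not) ψ

/-- Always: `G ψ = ¬F¬ψ`. -/
def QF.alw {AP V : Type} (ψ : QF AP V) : QF AP V := (QF.ev ψ.not).not

/-- The assignment obtained from the trivial one by performing the listed updates,
the head of the list last. -/
def asgnOfList {AP V : Type} [DecidableEq V] (l : List (V × Trace AP)) : V → Trace AP :=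
  l.foldr (fun p ρ => Function.update ρ p.1 p.2) (fun _ _ => ∅)

/-- The lists of updates all of whose traces lie in `S`. -/
def listsOver {AP : Type} (V : Type) (S : Set (Trace AP)) : Set (List (V × Trace AP)) :=
  {l | ∀ p ∈ l, p.2 ∈ S}

theorem listsOver_mono {AP V : Type} {S S' : Set (Trace AP)} (h : S ⊆ S') :
    listsOver V S ⊆ listsOver V S' :=
  fun _ hl p hp => h (hl p hp)

theorem cons_mem_listsOver {AP V : Type} {S : Set (Trace AP)} {π : V} {t : Trace AP}
    {l : List (V × Trace AP)} (ht : t ∈ S) (hl : l ∈ listsOver V S) :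
    (π, t) :: l ∈ listsOver V S :=
  List.forall_mem_cons.2 ⟨ht, hl⟩

theorem countable_listsOver {AP V : Type} [Countable V] {S : Set (Trace AP)}
    (hS : S.Countable) : (listsOver V S).Countable := by
  have := hS.to_subtype
  refine (Set.countable_range
    (fun l : List (V × S) => l.map (fun p => (p.1, (p.2 : Trace AP))))).mono ?_
  intro l hl
  induction l with
  | nil => exact ⟨[], rfl⟩
  | cons p l ih =>
    obtain ⟨hp, hl⟩ := List.forall_mem_cons.1 hl
    obtain ⟨l', rfl⟩ := ih hl
    exact ⟨(p.1, ⟨p.2, hp⟩) :: l', rfl⟩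

/-- A list of updates over an increasing union lies over one of its members. -/
theorem exists_mem_listsOver_of_iUnion {AP V : Type} {S : ℕ → Set (Trace AP)}
    (hS : Monotone S) {l : List (V × Trace AP)} (hl : l ∈ listsOver V (⋃ n, S n)) :
    ∃ n, l ∈ listsOver V (S n) := by
  induction l with
  | nil => exact ⟨0, by simp [listsOver]⟩
  | cons p l ih =>
    obtain ⟨hp, hl⟩ := List.forall_mem_cons.1 hl
    obtain ⟨m, hm⟩ := ih hl
    obtain ⟨k, hk⟩ := Set.mem_iUnion.1 hp
    exact ⟨max m k, cons_mem_listsOver (hS (le_max_right m k) hk)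
      (listsOver_mono (hS (le_max_left m k)) hm)⟩

/-- Every operation sending lists of updates over `T` to countable subsets of `T` has a
countable closed subset of `T`. -/
theorem exists_countable_closed {AP V : Type} [Countable V] {T : Set (Trace AP)}
    (F : List (V × Trace AP) → Set (Trace AP)) (hF : ∀ l, (F l).Countable)
    (hFT : ∀ l, F l ⊆ T) :
    ∃ S ⊆ T, S.Countable ∧ ∀ l ∈ listsOver V S, F l ⊆ S := by
  let S : ℕ → Set (Trace AP) :=
    fun n => Nat.rec ∅ (fun _ X => X ∪ ⋃ l ∈ listsOver V X, F l) n
  have hsucc : ∀ n, S (n + 1) = S n ∪ ⋃ l ∈ listsOver V (S n), F l := fun _ => rfl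
  have hmono : Monotone S :=
    monotone_nat_of_le_succ fun n => (hsucc n).symm ▸ Set.subset_union_left
  refine ⟨⋃ n, S n, Set.iUnion_subset fun n => ?_, Set.countable_iUnion fun n => ?_, ?_⟩
  · induction n with
    | zero => exact Set.empty_subset T
    | succ n ih =>
      rw [hsucc]
      exact Set.union_subset ih (Set.iUnion₂_subset fun l _ => hFT l)
  · induction n with
    | zero => exact Set.countable_empty
    | succ n ih =>
      rw [hsucc]
      exact ih.union ((countable_listsOver ih).biUnion fun l _ => hF l)
  · intro l hl
    obtain ⟨n, hn⟩ := exists_mem_listsOver_of_iUnion hmono hl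
    refine Set.Subset.trans ?_ (Set.subset_iUnion S (n + 1))
    rw [hsucc]
    exact (Set.subset_biUnion_of_mem (u := F) hn).trans Set.subset_union_right

/-- Skolem functions: satisfaction of `φ` passes from `T` to every subset of `T` that is
closed under a suitable operation. -/
theorem HyperLTL.exists_skolem {AP V : Type} [DecidableEq V] (T : Set (Trace AP))
    (φ : HyperLTL AP V) :
    ∃ F : List (V × Trace AP) → Set (Trace AP),
      (∀ l, (F l).Countable) ∧ (∀ l, F l ⊆ T) ∧
      ∀ S ⊆ T, (∀ l ∈ listsOver V S, F l ⊆ S) → ∀ l ∈ listsOver V S,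
        φ.sat T (asgnOfList l) → φ.sat S (asgnOfList l) := by
  induction φ with
  | qf ψ => exact ⟨fun _ => ∅, by simp, by simp, fun _ _ _ _ _ h => h⟩
  | all π φ ih =>
    obtain ⟨F, hF, hFT, h⟩ := ih
    exact ⟨F, hF, hFT, fun S hST hS l hl hsat t ht =>
      h S hST hS ((π, t) :: l) (cons_mem_listsOver ht hl) (hsat t (hST ht))⟩
  | exi π φ ih =>
    obtain ⟨F, hF, hFT, h⟩ := ih
    have hW : ∀ l : List (V × Trace AP), ∃ W : Set (Trace AP), W.Countable ∧ W ⊆ T ∧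
        ((HyperLTL.exi π φ).sat T (asgnOfList l) →
          ∃ t ∈ W, φ.sat T (asgnOfList ((π, t) :: l))) := by
      intro l
      by_cases hl : (HyperLTL.exi π φ).sat T (asgnOfList l)
      · obtain ⟨t, ht, hsat⟩ := hl
        exact ⟨{t}, Set.countable_singleton t, Set.singleton_subset_iff.2 ht,
          fun _ => ⟨t, rfl, hsat⟩⟩
      · exact ⟨∅, Set.countable_empty, Set.empty_subset T, fun h => absurd h hl⟩
    choose W hW hWT hWsat using hW
    refine ⟨fun l => F l ∪ W l, fun l => (hF l).union (hW l),
      fun l => Set.union_subset (hFT l) (hWT l), fun S hST hS l hl hsat => ?_⟩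
    obtain ⟨t, ht, hsat⟩ := hWsat l hsat
    have htS : t ∈ S := hS l hl (Or.inr ht)
    exact ⟨t, htS, h S hST (fun l hl => Set.subset_union_left.trans (hS l hl))
      ((π, t) :: l) (cons_mem_listsOver htS hl) hsat⟩

/-- Every satisfiable HyperLTL sentence has a countable model. -/
theorem hyperltl_countable_model {AP : Type} [Finite AP] (φ : HyperLTL AP ℕ)
    (hclosed : φ.Closed) (hsat : ∃ T : Set (Trace AP), HyperLTL.Models T φ) :
    ∃ S : Set (Trace AP), S.Countable ∧ HyperLTL.Models S φ := by
  obtain ⟨T, hT⟩ := hsat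
  obtain ⟨F, hF, hFT, h⟩ := φ.exists_skolem T
  obtain ⟨S, hST, hS, hcl⟩ := exists_countable_closed F hF hFT
  exact ⟨S, hS, h S hST hcl [] (by simp [listsOver]) hT⟩
end

section
/- Every nonempty model of a HyperLTL sentence contains a countable submodel: if φ is a HyperLTL sentence and T ⊨ φ for some nonempty set of traces T, then there exists a countable subset S ⊆ T with S ⊨ φ. Moreover S can be obtained as the closure of any single trace t ∈ T under Skolem functions for the existential quantifiers of φ. -/
/-- The lists of variable bindings all of whose traces lie in `S`. -/
def bindingsIn {α V : Type} (S : Set α) : Set (List (V × α)) :=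
  {l | ∀ p ∈ l, p.2 ∈ S}

theorem bindingsIn_cons {α V : Type} {S : Set α} {p : V × α} {l : List (V × α)} :
    p :: l ∈ bindingsIn S ↔ p.2 ∈ S ∧ l ∈ bindingsIn S := by
  simp only [bindingsIn, Set.mem_ofPred_eq, List.forall_mem_cons]

theorem bindingsIn_mono {α V : Type} {S S' : Set α} (h : S ⊆ S') :
    bindingsIn (V := V) S ⊆ bindingsIn S' :=
  fun _ hl p hp => h (hl p hp)

theorem countable_bindingsIn {α V : Type} [Countable V] {S : Set α} (hS : S.Countable) :
    (bindingsIn (V := V) S).Countable := by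
  have := ((Set.countable_univ (α := V)).prod hS).to_subtype
  have h : bindingsIn (V := V) S =
      Set.range (List.map ((↑) : (Set.univ ×ˢ S : Set (V × α)) → _)) := by
    rw [Set.range_list_map_coe]
    simp only [bindingsIn, Set.mem_prod, Set.mem_univ, true_and]
  rw [h]
  exact Set.countable_range _

theorem exists_mem_bindingsIn_of_iUnion {α V : Type} {S : ℕ → Set α} (hS : Monotone S)
    {l : List (V × α)} (hl : l ∈ bindingsIn (⋃ n, S n)) : ∃ n, l ∈ bindingsIn (S n) := by
  induction l with
  | nil => exact ⟨0, by simp [bindingsIn]⟩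
  | cons p l ih =>
    obtain ⟨hp, hl⟩ := bindingsIn_cons.1 hl
    obtain ⟨m, hm⟩ := Set.mem_iUnion.1 hp
    obtain ⟨n, hn⟩ := ih hl
    exact ⟨max m n, bindingsIn_cons.2
      ⟨hS (le_max_left m n) hm, bindingsIn_mono (hS (le_max_right m n)) hn⟩⟩

/-- `skolemStage G t n` contains the elements obtained from `t` by at most `n` nested
applications of the functions in `G`. -/
def skolemStage {α V : Type} (G : Set (List (V × α) → α)) (t : α) : ℕ → Set α
  | 0 => {t}
  | n + 1 => skolemStage G t n ∪ ⋃ g ∈ G, g '' bindingsIn (skolemStage G t n)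

theorem skolemStage_mono {α V : Type} (G : Set (List (V × α) → α)) (t : α) :
    Monotone (skolemStage G t) :=
  monotone_nat_of_le_succ fun _ => Set.subset_union_left

/-- The closure of `t` under the functions in `G`. -/
def skolemClosure {α V : Type} (G : Set (List (V × α) → α)) (t : α) : Set α :=
  ⋃ n, skolemStage G t n

theorem mem_skolemClosure_self {α V : Type} (G : Set (List (V × α) → α)) (t : α) :
    t ∈ skolemClosure G t :=
  Set.mem_iUnion.2 ⟨0, rfl⟩

theorem countable_skolemClosure {α V : Type} [Countable V] {G : Set (List (V × α) → α)}
    (hG : G.Countable) (t : α) : (skolemClosure G t).Countable := by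
  refine Set.countable_iUnion fun n => ?_
  induction n with
  | zero => exact Set.countable_singleton t
  | succ n ih => exact ih.union (hG.biUnion fun g _ => (countable_bindingsIn ih).image g)

theorem skolemClosure_subset {α V : Type} {G : Set (List (V × α) → α)} {t : α} {T : Set α}
    (ht : t ∈ T) (hG : ∀ g ∈ G, ∀ l, g l ∈ T) : skolemClosure G t ⊆ T := by
  refine Set.iUnion_subset fun n => ?_
  induction n with
  | zero => exact Set.singleton_subset_iff.2 ht
  | succ n ih =>
    refine Set.union_subset ih (Set.iUnion₂_subset fun g hg => ?_)
    rintro _ ⟨l, -, rfl⟩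
    exact hG g hg l

theorem skolemClosure_closed {α V : Type} {G : Set (List (V × α) → α)} {t : α} :
    ∀ g ∈ G, ∀ l ∈ bindingsIn (skolemClosure G t), g l ∈ skolemClosure G t := by
  intro g hg l hl
  obtain ⟨n, hn⟩ := exists_mem_bindingsIn_of_iUnion (skolemStage_mono G t) hl
  exact Set.mem_iUnion.2 ⟨n + 1, Or.inr (Set.mem_biUnion hg ⟨l, hn, rfl⟩)⟩

/-- The trace assignment obtained from `ρ` by applying the bindings in `l`, the head last. -/
def bindAll {AP V : Type} [DecidableEq V] (ρ : V → Trace AP) (l : List (V × Trace AP)) :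
    V → Trace AP :=
  l.foldr (fun p σ => Function.update σ p.1 p.2) ρ

/-- A formula has countably many Skolem functions over `T` such that satisfaction over `T` passes
to every subset of `T` closed under them. -/
theorem HyperLTL.exists_skolem_functions {AP V : Type} [DecidableEq V] {T : Set (Trace AP)}
    (hT : T.Nonempty) (ρ : V → Trace AP) (φ : HyperLTL AP V) :
    ∃ G : Set (List (V × Trace AP) → Trace AP), G.Countable ∧ (∀ g ∈ G, ∀ l, g l ∈ T) ∧
      ∀ S ⊆ T, (∀ g ∈ G, ∀ l ∈ bindingsIn S, g l ∈ S) →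
        ∀ l ∈ bindingsIn S, φ.sat T (bindAll ρ l) → φ.sat S (bindAll ρ l) := by
  induction φ with
  | qf ψ => exact ⟨∅, Set.countable_empty, by simp, fun _ _ _ _ _ h => h⟩
  | all π φ ih =>
    obtain ⟨G, hG, hGT, hsat⟩ := ih
    exact ⟨G, hG, hGT, fun S hST hS l hl h s hs =>
      hsat S hST hS ((π, s) :: l) (bindingsIn_cons.2 ⟨hs, hl⟩) (h s (hST hs))⟩
  | exi π φ ih =>
    obtain ⟨G, hG, hGT, hsat⟩ := ih
    have witness (l : List (V × Trace AP)) : ∃ s ∈ T, (HyperLTL.exi π φ).sat T (bindAll ρ l) →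
        φ.sat T (Function.update (bindAll ρ l) π s) := by
      by_cases h : (HyperLTL.exi π φ).sat T (bindAll ρ l)
      · obtain ⟨s, hs, h'⟩ := h
        exact ⟨s, hs, fun _ => h'⟩
      · exact ⟨hT.some, hT.some_mem, fun h' => (h h').elim⟩
    choose f hfT hf using witness
    refine ⟨insert f G, hG.insert f, Set.forall_mem_insert.2 ⟨hfT, hGT⟩, fun S hST hS l hl h => ?_⟩
    obtain ⟨hfS, hGS⟩ := Set.forall_mem_insert.1 hS
    exact ⟨f l, hfS l hl,
      hsat S hST hGS ((π, f l) :: l) (bindingsIn_cons.2 ⟨hfS l hl, hl⟩) (hf l h)⟩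

/-- Every nonempty model of a HyperLTL sentence contains a countable
submodel; moreover the submodel can be chosen to contain any given trace `t ∈ T`
(it is obtained as the closure of `t` under Skolem functions). -/
theorem hyperltl_countable_submodel {AP : Type} [Finite AP] (φ : HyperLTL AP ℕ)
    (hclosed : φ.Closed) (T : Set (Trace AP)) (hT : HyperLTL.Models T φ)
    (t : Trace AP) (ht : t ∈ T) :
    ∃ S : Set (Trace AP), S ⊆ T ∧ S.Countable ∧ t ∈ S ∧ HyperLTL.Models S φ := by
  obtain ⟨G, hG, hGT, hsat⟩ := φ.exists_skolem_functions ⟨t, ht⟩ (fun _ _ => ∅)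
  have hsub := skolemClosure_subset ht hGT
  exact ⟨skolemClosure G t, hsub, countable_skolemClosure hG t, mem_skolemClosure_self G t,
    hsat _ hsub skolemClosure_closed [] (by simp [bindingsIn]) hT⟩
end

section
/- There is a satisfiable HyperLTL sentence that is not satisfied by any ω-contextfree set of traces: there exists a HyperLTL sentence φ over a finite set AP of atomic propositions such that some set of traces satisfies φ, but no set of traces T with T ⊨ φ is an ω-contextfree language over the alphabet 2^AP. -/
/-- The finite segment `w(i) w(i+1) ⋯ w(j-1)` of an infinite word `w`. -/
def seg {α : Type} (w : ℕ → α) (i j : ℕ) : List α :=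
  (List.range (j - i)).map fun m => w (i + m)

/-- `w ∈ U · V^ω`: the infinite word `w` decomposes as `u · v₀ · v₁ · v₂ ⋯` with
`u ∈ U` and `vᵢ ∈ V` for all `i`, given by the sequence `c` of cut points
(`u = w[0,c 0)`, `vᵢ = w[c i, c (i+1))`). -/
def InOmegaProd {α : Type} (U V : Language α) (w : ℕ → α) : Prop :=
  ∃ c : ℕ → ℕ, seg w 0 (c 0) ∈ U ∧ ∀ i, seg w (c i) (c (i + 1)) ∈ V

/-- An ω-language `L` is ω-regular if `L = ⋃_{i=1}^{m} Uᵢ·Vᵢ^ω` for finitely many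
regular languages `Uᵢ, Vᵢ` of finite words with `ε ∉ Vᵢ`. -/
def IsOmegaRegular {α : Type} (L : Set (ℕ → α)) : Prop :=
  ∃ (m : ℕ) (U V : Fin m → Language α),
    (∀ i, (U i).IsRegular ∧ (V i).IsRegular ∧ [] ∉ V i) ∧
    L = { w | ∃ i, InOmegaProd (U i) (V i) w }

/-- An ω-language `L` is ω-contextfree if `L = ⋃_{i=1}^{m} Uᵢ·Vᵢ^ω` for finitely many
context-free languages `Uᵢ, Vᵢ` of finite words with `ε ∉ Vᵢ` (Cohen–Gold). -/
def IsOmegaContextFree {α : Type} (L : Set (ℕ → α)) : Prop :=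
  ∃ (m : ℕ) (U V : Fin m → Language α),
    (∀ i, (U i).IsContextFree ∧ (V i).IsContextFree ∧ [] ∉ V i) ∧
    L = { w | ∃ i, InOmegaProd (U i) (V i) w }

section DerivedOperators

variable {AP V : Type}

theorem QF.sat_and (ρ : V → Trace AP) (ψ₁ ψ₂ : QF AP V) :
    (ψ₁.and ψ₂).sat ρ ↔ ψ₁.sat ρ ∧ ψ₂.sat ρ := by
  simp [QF.and, QF.sat]

theorem QF.sat_ev (ρ : V → Trace AP) (ψ : QF AP V) :
    ψ.ev.sat ρ ↔ ∃ j, ψ.sat (shiftAsgn ρ j) := by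
  simp [QF.ev, QF.sat, em]

theorem QF.sat_alw (ρ : V → Trace AP) (ψ : QF AP V) :
    ψ.alw.sat ρ ↔ ∀ j, ψ.sat (shiftAsgn ρ j) := by
  simp [QF.alw, QF.sat, QF.sat_ev]

end DerivedOperators

section PeriodicWords

variable {α : Type}

/-- The ultimately periodic word `u · v^ω`. -/
def lassoWord [Inhabited α] (u v : List α) (n : ℕ) : α :=
  if n < u.length then u.getD n default else v.getD ((n - u.length) % v.length) default

theorem lassoWord_add_period [Inhabited α] (u v : List α) {n : ℕ} (hn : u.length ≤ n) :
    lassoWord u v (n + v.length) = lassoWord u v n := by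
  have h : n + v.length - u.length = n - u.length + v.length := by omega
  simp [lassoWord, h, show ¬ n < u.length by omega, show ¬ n + v.length < u.length by omega]

theorem lassoWord_inOmegaProd [Inhabited α] {U V : Language α} {u v : List α}
    (hu : u ∈ U) (hv : v ∈ V) : InOmegaProd U V (lassoWord u v) := by
  refine ⟨fun i => u.length + i * v.length, ?_, fun i => ?_⟩
  · convert hu
    refine List.ext_getElem (by simp [seg]) fun n h₁ h₂ => ?_
    simp [seg, lassoWord, h₂]
  · convert hv
    refine List.ext_getElem (by simp only [seg, List.length_map, List.length_range, add_mul]; omega)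
      fun n h₁ h₂ => ?_
    have h : u.length + i * v.length + n - u.length = n + v.length * i := by
      rw [mul_comm]; omega
    simp [seg, lassoWord, h, Nat.mod_eq_of_lt h₂, h₂,
      show ¬ u.length + i * v.length + n < u.length by omega]

/-- Every nonempty ω-contextfree language contains an ultimately periodic word. -/
theorem IsOmegaContextFree.exists_ultimately_periodic [Inhabited α] {L : Set (ℕ → α)}
    (hL : IsOmegaContextFree L) (hne : L.Nonempty) :
    ∃ w ∈ L, ∃ s d, 0 < d ∧ ∀ n, s ≤ n → w (n + d) = w n := by
  obtain ⟨m, U, V, hUV, rfl⟩ := hL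
  obtain ⟨w, i, c, hu, hv⟩ := hne
  have hnil : seg w (c 0) (c 1) ≠ [] := fun h => (hUV i).2.2 (h ▸ hv 0)
  exact ⟨_, ⟨i, lassoWord_inOmegaProd hu (hv 0)⟩, _, _, List.length_pos_iff.2 hnil,
    fun n hn => lassoWord_add_period _ _ hn⟩

end PeriodicWords

section Refinement

/-- `Refines P Q`: eventually, every element of `P` belongs to `Q` and is followed by an element
of `Q` outside `P` before the next element of `P`. -/
def Refines (P Q : Set ℕ) : Prop :=
  ∃ N, ∀ n ≥ N, n ∈ P → n ∈ Q ∧ ∃ k > n, k ∈ Q ∧ ∀ m, n < m → m ≤ k → m ∉ P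

/-- The quantifier-free formula expressing that the positions carrying the proposition on trace `1`
are infinitely many and refined by those on trace `2`. -/
def refinementBody : QF (Fin 1) ℕ :=
  let p : QF (Fin 1) ℕ := .atom 0 1
  let q : QF (Fin 1) ℕ := .atom 0 2
  p.ev.alw.and (QF.or p.not (q.and (QF.untl p.not (q.and p.not)).next)).alw.ev

theorem refinementBody_sat (ρ : ℕ → Trace (Fin 1)) :
    refinementBody.sat ρ ↔ {n | 0 ∈ ρ 1 n}.Infinite ∧
      Refines {n | 0 ∈ ρ 1 n} {n | 0 ∈ ρ 2 n} := by
  simp only [refinementBody, QF.sat_and, QF.sat_ev, QF.sat_alw, QF.sat, shiftAsgn]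
  refine and_congr ?_ (exists_congr fun N => ⟨fun h n hn hp => ?_, fun h n => ?_⟩)
  · rw [← Nat.frequently_atTop_iff_infinite, Filter.frequently_atTop]
    refine forall_congr' fun N => ⟨?_, ?_⟩
    · rintro ⟨i, hi⟩
      exact ⟨_, by omega, hi⟩
    · rintro ⟨i, hi, hp⟩
      refine ⟨i - N, ?_⟩
      simpa [show i - N + N = i by omega] using hp
  · obtain ⟨i, rfl⟩ := Nat.exists_eq_add_of_le hn
    obtain ⟨hq, j, ⟨hj, hj'⟩, hlt⟩ := (h i).resolve_left (by
      simpa [add_comm, add_left_comm] using hp)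
    refine ⟨by simpa [add_comm, add_left_comm] using hq, _, ?_, hj, fun m hm hmk => ?_⟩
    · omega
    · rcases hmk.eq_or_lt with rfl | hlt'
      · exact hj'
      · have := hlt (m - (N + i + 1)) (by omega)
        convert this using 3
        simp only [Set.mem_ofPred_eq]
        rw [show 0 + (m - (N + i + 1)) + 1 + i + N = m by omega]
  · by_cases hp : 0 ∈ ρ 1 (n + N)
    · obtain ⟨hq, k, hk, hkq, hlt⟩ := h (n + N) (by omega) hp
      refine .inr ⟨by simpa using hq, k - (n + N + 1), ⟨?_, ?_⟩, fun j hj => ?_⟩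
      · rw [show 0 + (k - (n + N + 1)) + 1 + n + N = k by omega]
        exact hkq
      · rw [show 0 + (k - (n + N + 1)) + 1 + n + N = k by omega]
        exact hlt k hk le_rfl
      · exact hlt _ (by omega) (by omega)
    · exact .inl (by simpa using hp)

/-- The sentence `∃π₀. ∀π₁. ∃π₂. refinementBody`. -/
def refinementSentence : HyperLTL (Fin 1) ℕ := .exi 0 (.all 1 (.exi 2 (.qf refinementBody)))

theorem refinementSentence_closed : refinementSentence.Closed := by
  ext v
  simp [refinementSentence, HyperLTL.free, refinementBody, QF.and, QF.ev, QF.alw, QF.free]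

theorem models_refinementSentence (T : Set (Trace (Fin 1))) :
    HyperLTL.Models T refinementSentence ↔ T.Nonempty ∧ ∀ t ∈ T, {n | 0 ∈ t n}.Infinite ∧
      ∃ t' ∈ T, Refines {n | 0 ∈ t n} {n | 0 ∈ t' n} := by
  simp only [HyperLTL.Models, refinementSentence, HyperLTL.sat, refinementBody_sat]
  simp only [Function.update_self, ne_eq, OfNat.one_ne_ofNat, not_false_eq_true,
    Function.update_of_ne]
  refine ⟨?_, ?_⟩
  · rintro ⟨t, ht, h⟩
    refine ⟨⟨t, ht⟩, fun t ht => ?_⟩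
    obtain ⟨t', ht', hi, hr⟩ := h t ht
    exact ⟨hi, t', ht', hr⟩
  · rintro ⟨⟨t, ht⟩, h⟩
    refine ⟨t, ht, fun t ht => ?_⟩
    obtain ⟨hi, t', ht', hr⟩ := h t ht
    exact ⟨t', ht', hi, hr⟩

/-- A family of sets closed under taking some refinement has no member in which pairs of
elements at distance at most `g` recur. -/
theorem not_frequently_gap_le {F : Set (Set ℕ)} (hF : ∀ P ∈ F, ∃ Q ∈ F, Refines P Q) (g : ℕ) :
    ∀ P ∈ F, ¬ ∀ N, ∃ i ≥ N, i ∈ P ∧ ∃ j ∈ P, i < j ∧ j ≤ i + g := by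
  induction g with
  | zero =>
    intro P _ h
    obtain ⟨i, -, -, j, -, hij, hji⟩ := h 0
    omega
  | succ g ih =>
    intro P hP h
    obtain ⟨Q, hQ, N, hN⟩ := hF P hP
    refine ih Q hQ fun M => ?_
    obtain ⟨i, hi, hiP, j, hjP, hij, hji⟩ := h (max M N)
    obtain ⟨hiQ, k, hik, hkQ, hk⟩ := hN i (le_trans (le_max_right _ _) hi) hiP
    refine ⟨i, le_trans (le_max_left _ _) hi, hiQ, k, hkQ, hik, ?_⟩
    by_contra hlt
    exact hk j hij (by omega) hjP

/-- The numbers whose binary expansion vanishes below its leading `n + 1` digits. -/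
def dyadicSet (n : ℕ) : Set ℕ := {m | 2 ^ (Nat.log 2 m - n) ∣ m}

theorem dyadicSet_infinite (n : ℕ) : (dyadicSet n).Infinite := by
  refine Set.infinite_of_injective_forall_mem (Nat.pow_right_injective le_rfl) fun k => ?_
  simp only [dyadicSet, Set.mem_ofPred_eq, Nat.log_pow one_lt_two]
  exact pow_dvd_pow _ (Nat.sub_le _ _)

theorem dyadicSet_refines (n : ℕ) : Refines (dyadicSet n) (dyadicSet (n + 1)) := by
  refine ⟨2 ^ (n + 1), fun i hi hiP => ?_⟩
  have hi₀ : i ≠ 0 := by have := Nat.two_pow_pos (n + 1); omega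
  obtain ⟨e, he⟩ := Nat.exists_eq_add_of_le ((Nat.le_log_iff_pow_le one_lt_two hi₀).2 hi)
  have hlow : 2 ^ (n + 1 + e) ≤ i := he ▸ Nat.pow_log_le_self 2 hi₀
  have hhigh : i < 2 ^ (n + 1 + e + 1) := he ▸ Nat.lt_pow_succ_log_self one_lt_two i
  have hd : 0 < 2 ^ e := Nat.two_pow_pos e
  have hdvd : 2 ^ (e + 1) ∣ i := by
    simpa [dyadicSet, he, show n + 1 + e - n = e + 1 by omega] using hiP
  have hnext : i + 2 ^ (e + 1) ≤ 2 ^ (n + 1 + e + 1) := by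
    obtain ⟨a, ha⟩ := hdvd
    obtain ⟨b, hb⟩ : 2 ^ (e + 1) ∣ 2 ^ (n + 1 + e + 1) := pow_dvd_pow 2 (by omega)
    rw [ha, hb] at hhigh ⊢
    have := Nat.lt_of_mul_lt_mul_left hhigh
    rw [← Nat.mul_succ]
    exact Nat.mul_le_mul_left _ this
  have hlog : ∀ m, i ≤ m → m < i + 2 ^ (e + 1) → Nat.log 2 m = n + 1 + e := fun m h₁ h₂ =>
    Nat.log_eq_of_pow_le_of_lt_pow (hlow.trans h₁) (h₂.trans_le hnext)
  have hdvd' : 2 ^ e ∣ i := (pow_dvd_pow 2 (Nat.le_succ e)).trans hdvd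
  rw [pow_succ] at hdvd hlog
  refine ⟨?_, i + 2 ^ e, by omega, ?_, fun m him hmi hm => ?_⟩
  · simpa [dyadicSet, he] using hdvd'
  · simpa [dyadicSet, hlog (i + 2 ^ e) (by omega) (by omega)] using hdvd'
  · simp only [dyadicSet, Set.mem_ofPred_eq, hlog m (by omega) (by omega),
      show n + 1 + e - n = e + 1 by omega, pow_succ] at hm
    have := Nat.le_of_dvd (by omega) (Nat.dvd_sub hm hdvd)
    omega

end Refinement

/-- There is a satisfiable HyperLTL sentence (over a finite set `AP`
of atomic propositions) that is not satisfied by any ω-contextfree set of traces. -/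
theorem hyperltl_no_omega_contextfree_model :
    ∃ (N : ℕ) (φ : HyperLTL (Fin N) ℕ), φ.Closed ∧
      (∃ T : Set (Trace (Fin N)), HyperLTL.Models T φ) ∧
      ∀ T : Set (Trace (Fin N)), HyperLTL.Models T φ → ¬ IsOmegaContextFree T := by
  refine ⟨1, refinementSentence, refinementSentence_closed,
    ⟨Set.range fun n m => {_a | m ∈ dyadicSet n}, ?_⟩, fun T hT hcf => ?_⟩
  · rw [models_refinementSentence]
    refine ⟨Set.range_nonempty _, ?_⟩
    rintro _ ⟨n, rfl⟩
    exact ⟨dyadicSet_infinite n, _, ⟨n + 1, rfl⟩, dyadicSet_refines n⟩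
  · obtain ⟨hne, hT⟩ := (models_refinementSentence T).1 hT
    obtain ⟨t, ht, s, d, hd, hper⟩ := hcf.exists_ultimately_periodic hne
    refine not_frequently_gap_le (F := (fun t : Trace (Fin 1) => {n | 0 ∈ t n}) '' T) ?_ d _
      ⟨t, ht, rfl⟩ fun N => ?_
    · rintro _ ⟨t, ht, rfl⟩
      obtain ⟨-, t', ht', hr⟩ := hT t ht
      exact ⟨_, ⟨t', ht', rfl⟩, hr⟩
    · obtain ⟨i, hi, hlt⟩ := (hT t ht).1.exists_gt (max N s)
      refine ⟨i, by omega, hi, i + d, ?_, by omega, le_rfl⟩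
      simpa only [Set.mem_ofPred_eq, hper i (by omega)] using hi
end

section
/- HyperLTL can encode the prime numbers: there exists a satisfiable HyperLTL sentence φ over a finite set AP of atomic propositions containing a, 1, and ' such that for every set of traces T with T ⊨ φ and every c ≥ 1, c is a prime number if and only if there exists a trace t ∈ T with 1 ∈ t(0), ' ∈ t(0), a ∈ t(c−1), and a ∉ t(n) for all n ≠ c−1. -/
namespace QF

variable {AP V : Type}

/-- Implication, as a derived operator. -/
def imp (ψ₁ ψ₂ : QF AP V) : QF AP V := .or ψ₁.not ψ₂

/-- Equivalence, as a derived operator. -/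
def iff (ψ₁ ψ₂ : QF AP V) : QF AP V := (ψ₁.imp ψ₂).and (ψ₂.imp ψ₁)

section Semantics

variable (ρ : V → Trace AP) (ψ ψ₁ ψ₂ : QF AP V)

theorem sat_and_s10 : (ψ₁.and ψ₂).sat ρ ↔ ψ₁.sat ρ ∧ ψ₂.sat ρ := by
  simp [QF.and, sat]

theorem sat_imp : (ψ₁.imp ψ₂).sat ρ ↔ (ψ₁.sat ρ → ψ₂.sat ρ) := by
  simp [imp, sat, imp_iff_not_or]

theorem sat_iff : (ψ₁.iff ψ₂).sat ρ ↔ (ψ₁.sat ρ ↔ ψ₂.sat ρ) := by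
  simp only [iff, sat_and_s10, sat_imp, iff_iff_implies_and_implies]

theorem sat_ev_s10 : ψ.ev.sat ρ ↔ ∃ j, ψ.sat (shiftAsgn ρ j) := by
  simp [ev, sat, em]

theorem sat_alw_s10 : ψ.alw.sat ρ ↔ ∀ j, ψ.sat (shiftAsgn ρ j) := by
  simp [alw, sat_ev_s10, sat]

theorem free_and : (ψ₁.and ψ₂).free = ψ₁.free ∪ ψ₂.free := rfl

theorem free_imp : (ψ₁.imp ψ₂).free = ψ₁.free ∪ ψ₂.free := rfl

theorem free_iff : (ψ₁.iff ψ₂).free = ψ₁.free ∪ ψ₂.free := by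
  simp only [iff, free_and, free_imp, Set.union_comm ψ₂.free, Set.union_self]

theorem free_ev : ψ.ev.free = ψ.free := by
  simp [ev, free]

theorem free_alw : ψ.alw.free = ψ.free := by
  simp [alw, free, free_ev]

end Semantics

end QF

/-! Propositions: `0` is the position marker `a`, `1` is the type `1`, `2` is the prime mark, `3` is a
shifted copy of the pattern `4`. Position `n` stands for the number `n + 1`. -/

namespace PrimeEncoding

open QF

/-- Proposition `0` holds exactly once on `π`. -/
def uniqueMarker (π : ℕ) : QF (Fin 5) ℕ :=
  .untl (atom 0 π).not ((atom 0 π).and (atom 0 π).not.alw.next)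

/-- The two patterns of `π` coincide, and they first hold at the position of the marker. -/
def isStart (π : ℕ) : QF (Fin 5) ℕ :=
  ((atom 3 π).iff (atom 4 π)).alw.and
    (.untl (atom 4 π).not ((atom 0 π).and (atom 4 π)))

/-- The mark on `π` records whether the marker is in the set of marked positions of `σ`. -/
def markedBy (σ π : ℕ) : QF (Fin 5) ℕ :=
  (atom 1 π).and ((atom 2 π).iff ((atom 0 π).and (atom 2 σ)).ev)

/-- `π'` is a start trace whose marker is one position later than that of `π`. -/
def succStart (π π' : ℕ) : QF (Fin 5) ℕ :=
  (isStart π').and ((atom 0 π).iff (atom 0 π').next).alw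

/-- Either the marker of `π` is at the origin and proposition `4` is proposition `3` shifted, or
`π'` has the marker and proposition `3` moved by one position. -/
def shiftStep (π π' : ℕ) : QF (Fin 5) ℕ :=
  .or ((atom 0 π).and ((atom 4 π).iff (atom 3 π).next).alw)
    ((atom 0 π).not.and
      ((((atom 0 π).next.iff (atom 0 π')).and
        (((atom 3 π).next.iff (atom 3 π')).and ((atom 4 π).iff (atom 4 π')))).alw))

/-- Later positions in the pattern of a start trace of period at least two are not marked. -/
def sieve (σ π : ℕ) : QF (Fin 5) ℕ :=
  ((isStart π).and (atom 0 π).not).imp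
    ((atom 0 π).imp ((atom 4 π).imp (atom 2 σ).not).alw.next).alw

/-- Unless the marker of `π` is at the origin or at a marked position of `σ`, it lies in the pattern
of the start trace `π'` and after the marker of `π'`, which is not at the origin. -/
def divisor (σ π π' : ℕ) : QF (Fin 5) ℕ :=
  .or (atom 0 π) (.or ((atom 0 π).and (atom 2 σ)).ev
    (((isStart π').and (atom 0 π').not).and
      ((atom 0 π').and ((atom 0 π).and (atom 4 π')).ev.next).ev))

/-- The quantifier-free part of the sentence. -/
def matrix : QF (Fin 5) ℕ :=
  ((atom 0 0).and (atom 2 0).not).and <|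
    (uniqueMarker 1).and <| (markedBy 0 1).and <| (succStart 1 2).and <|
      (shiftStep 1 3).and <| (sieve 0 1).and <| divisor 0 1 4

/-- The sentence encoding the primes. -/
def sentence : HyperLTL (Fin 5) ℕ :=
  .exi 0 <| .all 1 <| .exi 2 <| .exi 3 <| .exi 4 <| .qf matrix

theorem closed_sentence : sentence.Closed := by
  ext n
  simp [sentence, HyperLTL.free, matrix, uniqueMarker, isStart, markedBy, succStart, shiftStep,
    sieve, divisor, free_and, free_imp, free_iff, free_ev, free_alw, QF.free]

/-- Semantic counterpart of `uniqueMarker`. -/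
def MarkerAt (t : Trace (Fin 5)) (i : ℕ) : Prop := ∀ n, 0 ∈ t n ↔ n = i

/-- Semantic counterpart of `isStart`. -/
def IsStart (t : Trace (Fin 5)) : Prop :=
  (∀ n, 3 ∈ t n ↔ 4 ∈ t n) ∧ ∃ j, (0 ∈ t j ∧ 4 ∈ t j) ∧ ∀ k < j, 4 ∉ t k

theorem sat_isStart (ρ : ℕ → Trace (Fin 5)) (π : ℕ) : (isStart π).sat ρ ↔ IsStart (ρ π) := by
  simp [isStart, IsStart, sat_and_s10, sat_alw_s10, sat_iff, QF.sat, shiftAsgn]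

theorem sat_uniqueMarker (ρ : ℕ → Trace (Fin 5)) (π : ℕ) :
    (uniqueMarker π).sat ρ ↔ ∃ i, MarkerAt (ρ π) i := by
  simp only [uniqueMarker, MarkerAt, sat_and_s10, sat_alw_s10, QF.sat, shiftAsgn]
  refine exists_congr fun i => ⟨fun ⟨⟨h, h₁⟩, h₂⟩ n => ⟨fun hn => ?_, ?_⟩, fun h => ?_⟩
  · rcases lt_trichotomy n i with hi | hi | hi
    · exact absurd (by simpa using hn) (h₂ n hi)
    · exact hi
    · obtain ⟨k, rfl⟩ := Nat.exists_eq_add_of_lt hi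
      exact absurd (by convert hn using 2; omega) (h₁ k)
  · rintro rfl
    simpa using h
  · simp only [h]
    exact ⟨⟨by omega, fun j => by omega⟩, fun j hj => by omega⟩

/-- Semantic counterpart of `matrix`. -/
structure Matrix (s t u v w : Trace (Fin 5)) : Prop where
  base : 0 ∈ s 0
  base_not_marked : 2 ∉ s 0
  marker : ∃ i, MarkerAt t i
  one : 1 ∈ t 0
  marked : 2 ∈ t 0 ↔ ∃ n, 0 ∈ t n ∧ 2 ∈ s n
  start : IsStart u
  succ : ∀ n, 0 ∈ t n ↔ 0 ∈ u (n + 1)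
  shift : (0 ∈ t 0 ∧ ∀ n, 4 ∈ t n ↔ 3 ∈ t (n + 1)) ∨
    (0 ∉ t 0 ∧ ∀ n, (0 ∈ t (n + 1) ↔ 0 ∈ v n) ∧ (3 ∈ t (n + 1) ↔ 3 ∈ v n) ∧ (4 ∈ t n ↔ 4 ∈ v n))
  sieve : IsStart t → 0 ∉ t 0 → ∀ n, 0 ∈ t n → ∀ k, 4 ∈ t (n + 1 + k) → 2 ∉ s (n + 1 + k)
  divisor : 0 ∈ t 0 ∨ (∃ n, 0 ∈ t n ∧ 2 ∈ s n) ∨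
    (IsStart w ∧ 0 ∉ w 0) ∧ ∃ n, 0 ∈ w n ∧ ∃ k, 0 ∈ t (n + 1 + k) ∧ 4 ∈ w (n + 1 + k)

theorem models_sentence (T : Set (Trace (Fin 5))) :
    HyperLTL.Models T sentence ↔
      ∃ s ∈ T, ∀ t ∈ T, ∃ u ∈ T, ∃ v ∈ T, ∃ w ∈ T, Matrix s t u v w := by
  have key (ρ : ℕ → Trace (Fin 5)) :
      matrix.sat ρ ↔ Matrix (ρ 0) (ρ 1) (ρ 2) (ρ 3) (ρ 4) := by
    simp only [matrix, markedBy, succStart, shiftStep, sieve, divisor, sat_and_s10, sat_imp, sat_iff,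
      sat_ev_s10, sat_alw_s10, sat_isStart, sat_uniqueMarker, QF.sat, shiftAsgn, zero_add]
    constructor
    · rintro ⟨⟨h₁, h₂⟩, h₃, ⟨h₄, h₅⟩, ⟨h₆, h₇⟩, h₈, h₉, h₁₀⟩
      refine ⟨h₁, h₂, h₃, h₄, h₅, h₆, ?_, ?_, fun a b n c k => ?_, ?_⟩
      · grind
      · grind
      · grind
      · grind
    · rintro ⟨h₁, h₂, h₃, h₄, h₅, h₆, h₇, h₈, h₉, h₁₀⟩
      refine ⟨⟨h₁, h₂⟩, h₃, ⟨h₄, h₅⟩, ⟨h₆, ?_⟩, ?_, fun a n b k => ?_, ?_⟩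
      · grind
      · grind
      · grind
      · grind
  simp [HyperLTL.Models, sentence, HyperLTL.sat, key]

/-- The trace of period `d` with its marker at position `i`. -/
def modelTrace (d i : ℕ) : Trace (Fin 5) := fun n =>
  {x | (x = 0 ∧ n = i) ∨ x = 1 ∨ (x = 2 ∧ (if n = 0 then i + 1 else n + 1).Prime) ∨
    (x = 3 ∧ d ∣ n + d - i) ∨ (x = 4 ∧ d ∣ n + 1)}

section ModelTrace

variable (d i n : ℕ)

theorem zero_mem_modelTrace : 0 ∈ modelTrace d i n ↔ n = i := by simp [modelTrace]

theorem one_mem_modelTrace : 1 ∈ modelTrace d i n := by simp [modelTrace]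

theorem two_mem_modelTrace :
    2 ∈ modelTrace d i n ↔ (if n = 0 then i + 1 else n + 1).Prime := by simp [modelTrace]

theorem three_mem_modelTrace : 3 ∈ modelTrace d i n ↔ d ∣ n + d - i := by simp [modelTrace]

theorem four_mem_modelTrace : 4 ∈ modelTrace d i n ↔ d ∣ n + 1 := by simp [modelTrace]

end ModelTrace

theorem isStart_modelTrace (i : ℕ) : IsStart (modelTrace (i + 1) i) := by
  simp only [IsStart, zero_mem_modelTrace, three_mem_modelTrace, four_mem_modelTrace]
  refine ⟨fun n => by rw [show n + (i + 1) - i = n + 1 by omega], i, by simp, fun k hk h => ?_⟩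
  have := Nat.le_of_dvd (by omega) h
  omega

theorem exists_model : ∃ T, HyperLTL.Models T sentence := by
  refine ⟨{t | ∃ d i, i < d ∧ t = modelTrace d i}, (models_sentence _).2
    ⟨modelTrace 1 0, ⟨1, 0, by simp⟩, ?_⟩⟩
  rintro _ ⟨d, i, hi, rfl⟩
  refine ⟨modelTrace (i + 2) (i + 1), ⟨_, _, by omega, rfl⟩,
    modelTrace d (i - 1), ⟨_, _, by omega, rfl⟩,
    modelTrace ((i + 1).minFac - 1 + 1) ((i + 1).minFac - 1), ⟨_, _, by omega, rfl⟩, ?_⟩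
  have marked_iff : (∃ n, 0 ∈ modelTrace d i n ∧ 2 ∈ modelTrace 1 0 n) ↔ (i + 1).Prime := by
    simp only [zero_mem_modelTrace, two_mem_modelTrace, exists_eq_left]
    split_ifs with h <;> simp [h]
  constructor
  · simp [zero_mem_modelTrace]
  · simp [two_mem_modelTrace, Nat.not_prime_one]
  · exact ⟨i, fun n => zero_mem_modelTrace d i n⟩
  · exact one_mem_modelTrace d i 0
  · rw [marked_iff, two_mem_modelTrace, if_pos rfl]
  · exact isStart_modelTrace (i + 1)
  · simp [zero_mem_modelTrace]
  · simp only [zero_mem_modelTrace, three_mem_modelTrace, four_mem_modelTrace]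
    rcases Nat.eq_zero_or_pos i with rfl | h
    · refine .inl ⟨rfl, fun n => ?_⟩
      simp
    · refine .inr ⟨by omega, fun n => ⟨by omega, ?_, by trivial⟩⟩
      rw [show n + 1 + d - i = n + d - (i - 1) by omega]
  · rintro ⟨-, j, ⟨hj, hd⟩, -⟩ h₀ n hn k hk hp
    simp only [zero_mem_modelTrace, two_mem_modelTrace, four_mem_modelTrace] at *
    subst hj hn
    have := Nat.le_of_dvd (by omega) hd
    rw [if_neg (by omega)] at hp
    rcases (Nat.dvd_prime hp).1 hk with h | h <;> omega
  · rw [marked_iff]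
    simp only [zero_mem_modelTrace, four_mem_modelTrace]
    by_cases h₀ : i = 0
    · exact .inl h₀.symm
    by_cases hp : (i + 1).Prime
    · exact .inr (.inl hp)
    have h₂ : 2 ≤ (i + 1).minFac := (Nat.minFac_prime (by omega)).two_le
    have hlt : (i + 1).minFac < i + 1 := (Nat.not_prime_iff_minFac_lt (by omega)).1 hp
    refine .inr (.inr ⟨⟨isStart_modelTrace _, by omega⟩, _, rfl, i - (i + 1).minFac, by omega, ?_⟩)
    convert Nat.minFac_dvd (i + 1) using 1 <;> omega

section Soundness

variable {T : Set (Trace (Fin 5))} {s : Trace (Fin 5)}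
  (hT : ∀ t ∈ T, ∃ u ∈ T, ∃ v ∈ T, ∃ w ∈ T, Matrix s t u v w)
include hT

theorem four_iff_three_add (i : ℕ) : ∀ t ∈ T, 0 ∈ t i → ∀ n, 4 ∈ t n ↔ 3 ∈ t (n + i + 1) := by
  induction i with
  | zero =>
    intro t ht h n
    obtain ⟨u, -, v, -, w, -, M⟩ := hT t ht
    rcases M.shift with ⟨-, h'⟩ | ⟨h', -⟩
    · exact h' n
    · exact absurd h h'
  | succ i ih =>
    intro t ht h n
    obtain ⟨u, -, v, hv, w, -, M⟩ := hT t ht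
    rcases M.shift with ⟨h₀, -⟩ | ⟨-, h'⟩
    · obtain ⟨j, hj⟩ := M.marker
      have h₁ := (hj _).1 h₀
      have h₂ := (hj _).1 h
      omega
    · rw [(h' n).2.2, ih v hv ((h' i).1.1 h) n, ← (h' _).2.1]
      rfl

theorem IsStart.four_iff_dvd {t : Trace (Fin 5)} (hs : IsStart t) (ht : t ∈ T) {i : ℕ}
    (hi : 0 ∈ t i) (n : ℕ) : 4 ∈ t n ↔ i + 1 ∣ n + 1 := by
  obtain ⟨hpq, j, ⟨hj, hj4⟩, hlt⟩ := hs
  obtain ⟨_, -, _, -, _, -, M⟩ := hT t ht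
  obtain ⟨k, hk⟩ := M.marker
  obtain rfl : j = i := by rw [(hk _).1 hj, (hk _).1 hi]
  induction n using Nat.strong_induction_on with
  | _ n ih =>
    rcases lt_trichotomy n j with h | rfl | h
    · refine iff_of_false (hlt n h) fun hd => ?_
      have := Nat.le_of_dvd (by omega) hd
      omega
    · simpa using hj4
    · obtain ⟨m, rfl⟩ := Nat.exists_eq_add_of_lt h
      rw [show j + m + 1 = m + j + 1 by omega, ← hpq, ← four_iff_three_add hT j t ht hi,
        ih m (by omega), show m + j + 1 + 1 = (m + 1) + (j + 1) by omega, Nat.dvd_add_self_right]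

theorem exists_isStart (hs : s ∈ T) (i : ℕ) : ∃ t ∈ T, 0 ∈ t i ∧ (i ≠ 0 → IsStart t) := by
  induction i with
  | zero =>
    obtain ⟨_, -, _, -, _, -, M⟩ := hT s hs
    exact ⟨s, hs, M.base, by simp⟩
  | succ i ih =>
    obtain ⟨t, ht, h, -⟩ := ih
    obtain ⟨u, hu, _, -, _, -, M⟩ := hT t ht
    exact ⟨u, hu, (M.succ i).1 h, fun _ => M.start⟩

theorem not_mem_zero {t : Trace (Fin 5)} (ht : t ∈ T) {i n : ℕ} (hi : 0 ∈ t i) (hn : n ≠ i) :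
    0 ∉ t n := by
  obtain ⟨_, -, _, -, _, -, M⟩ := hT t ht
  obtain ⟨k, hk⟩ := M.marker
  intro h
  exact hn (by rw [(hk _).1 h, (hk _).1 hi])

theorem two_mem_iff_prime (hs : s ∈ T) (i : ℕ) : 2 ∈ s i ↔ (i + 1).Prime := by
  constructor
  · intro h
    rcases Nat.eq_zero_or_pos i with rfl | hi
    · obtain ⟨_, -, _, -, _, -, M⟩ := hT s hs
      exact absurd h M.base_not_marked
    by_contra hp
    have h₂ : 2 ≤ (i + 1).minFac := (Nat.minFac_prime (by omega)).two_le
    have hlt : (i + 1).minFac < i + 1 := (Nat.not_prime_iff_minFac_lt (by omega)).1 hp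
    obtain ⟨e, he⟩ : ∃ e, (i + 1).minFac = e + 1 := ⟨_, (Nat.sub_add_cancel (by omega)).symm⟩
    obtain ⟨t, ht, hte, hst⟩ := exists_isStart hT hs e
    have hst := hst (by omega)
    obtain ⟨_, -, _, -, _, -, M⟩ := hT t ht
    have hi' : e + 1 + (i - (e + 1)) = i := by omega
    refine M.sieve hst (not_mem_zero hT ht hte (by omega)) e hte (i - (e + 1)) ?_ ?_
    · rw [hi', hst.four_iff_dvd hT ht hte, ← he]
      exact Nat.minFac_dvd _
    · rwa [hi']
  · intro hp
    obtain ⟨t, ht, hti, -⟩ := exists_isStart hT hs i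
    obtain ⟨_, -, _, -, w, hw, M⟩ := hT t ht
    obtain ⟨j, hj⟩ := M.marker
    obtain rfl := (hj i).1 hti
    rcases M.divisor with h | ⟨n, hn, hs⟩ | ⟨⟨hstw, hw0⟩, n, hn, k, hk, hwk⟩
    · rw [hj] at h
      subst h
      exact absurd hp Nat.not_prime_one
    · rwa [(hj n).1 hn] at hs
    · have hk := (hj _).1 hk
      rw [hstw.four_iff_dvd hT hw hn, hk] at hwk
      have hn0 : n ≠ 0 := by
        rintro rfl
        exact hw0 hn
      rcases (Nat.dvd_prime hp).1 hwk with h | h <;> omega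

end Soundness

end PrimeEncoding

/-- HyperLTL can encode the prime numbers: there is a satisfiable
HyperLTL sentence `φ` over a finite set `AP` containing (pairwise distinct) propositions
`a`, `1`, and `'` such that in every model `T` of `φ` and for every `c ≥ 1`:
`c` is prime iff `T` contains a trace of characteristic `c` (i.e., `a` holds exactly at
position `c-1`) that is of type 1 and marked with `'` at its first position. -/
theorem hyperltl_encodes_primes :
    ∃ (N : ℕ) (a one prime : Fin N) (φ : HyperLTL (Fin N) ℕ),
      a ≠ one ∧ a ≠ prime ∧ one ≠ prime ∧
      φ.Closed ∧ (∃ T : Set (Trace (Fin N)), HyperLTL.Models T φ) ∧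
      ∀ T : Set (Trace (Fin N)), HyperLTL.Models T φ →
        ∀ c : ℕ, 1 ≤ c →
          (Nat.Prime c ↔ ∃ t ∈ T, one ∈ t 0 ∧ prime ∈ t 0 ∧ a ∈ t (c - 1) ∧
            ∀ n : ℕ, n ≠ c - 1 → a ∉ t n) := by
  refine ⟨5, 0, 1, 2, PrimeEncoding.sentence, by decide, by decide, by decide,
    PrimeEncoding.closed_sentence, PrimeEncoding.exists_model, fun T hM c hc => ?_⟩
  obtain ⟨s, hs, hT⟩ := (PrimeEncoding.models_sentence T).1 hM
  obtain ⟨i, rfl⟩ : ∃ i, c = i + 1 := ⟨c - 1, by omega⟩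
  rw [Nat.add_sub_cancel, ← PrimeEncoding.two_mem_iff_prime hT hs]
  constructor
  · intro h
    obtain ⟨t, ht, hti, -⟩ := PrimeEncoding.exists_isStart hT hs i
    obtain ⟨_, -, _, -, _, -, M⟩ := hT t ht
    exact ⟨t, ht, M.one, M.marked.2 ⟨i, hti, h⟩, hti,
      fun n hn => PrimeEncoding.not_mem_zero hT ht hti hn⟩
  · rintro ⟨t, ht, -, hm, -, hu⟩
    obtain ⟨_, -, _, -, _, -, M⟩ := hT t ht
    obtain ⟨n, hn, hsn⟩ := M.marked.1 hm
    obtain rfl : n = i := by_contra fun h => hu n h hn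
    exact hsn
end

section
/- For every HyperLTL sentence φ there is a HyperFO sentence φ' such that for every set T of traces over AP: T ⊨ φ if and only if M(T) ⊨ φ'. -/
/-- Quantifier-free `FO[<,E]` formulas (atoms `x = y`, `x < y`, `E(x,y)`, `P_a(x)`,
negation, disjunction), with variables named by natural numbers. -/
inductive QFF (AP : Type) : Type
  | eq   : ℕ → ℕ → QFF AP
  | lt   : ℕ → ℕ → QFF AP
  | el   : ℕ → ℕ → QFF AP
  | prop : AP → ℕ → QFF AP
  | not  : QFF AP → QFF AP
  | or   : QFF AP → QFF AP → QFF AP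

/-- Satisfaction of quantifier-free `FO[<,E]` formulas: the valuation `β` assigns to
each variable an element `(t, n)` of the domain of `M(T)`; `(t,n) < (t',n')` iff
`t = t'` and `n < n'`; `E((t,n),(t',n'))` iff `n = n'`; `P_a((t,n))` iff `a ∈ t(n)`. -/
def QFF.sat {AP : Type} (β : ℕ → Trace AP × ℕ) : QFF AP → Prop
  | eq x y => β x = β y
  | lt x y => (β x).1 = (β y).1 ∧ (β x).2 < (β y).2
  | el x y => (β x).2 = (β y).2
  | prop a x => a ∈ (β x).1 (β x).2
  | not ψ => ¬ ψ.sat β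
  | or ψ₁ ψ₂ => ψ₁.sat β ∨ ψ₂.sat β

/-- Free variables of a quantifier-free `FO[<,E]` formula. -/
def QFF.free {AP : Type} : QFF AP → Set ℕ
  | eq x y => {x, y}
  | lt x y => {x, y}
  | el x y => {x, y}
  | prop _ x => {x}
  | not ψ => ψ.free
  | or ψ₁ ψ₂ => ψ₁.free ∪ ψ₂.free

/-- The guarded part `Q₁^G y₁ ≥ x_{g₁}. ⋯ Q_ℓ^G y_ℓ ≥ x_{g_ℓ}. ψ` of a HyperFO
sentence with guards `x₁, …, x_k`: `exG y g χ` stands for `∃^G y ≥ x_g. χ`, i.e.,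
`∃y. x_g ≤ y ∧ χ`, and `allG y g χ` for `∀^G y ≥ x_g. χ`, i.e., `∀y. x_g ≤ y → χ`. -/
inductive Guarded (AP : Type) (k : ℕ) : Type
  | base : QFF AP → Guarded AP k
  | exG  : ℕ → Fin k → Guarded AP k → Guarded AP k
  | allG : ℕ → Fin k → Guarded AP k → Guarded AP k

/-- Satisfaction of the guarded part in `M(T)`, given the traces `xs g` assigned to
the guards `x_g` (which, being quantified by `Q^M`, sit at the initial positions
`(xs g, 0)` of `M(T)`): a quantifier guarded by `x_g` ranges exactly over the
positions `(xs g, n)`, `n ∈ ℕ`, of the trace `xs g`. -/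
def Guarded.sat {AP : Type} {k : ℕ} (xs : Fin k → Trace AP) (β : ℕ → Trace AP × ℕ) :
    Guarded AP k → Prop
  | base ψ => ψ.sat β
  | exG y g χ => ∃ n : ℕ, χ.sat xs (Function.update β y (xs g, n))
  | allG y g χ => ∀ n : ℕ, χ.sat xs (Function.update β y (xs g, n))

/-- Well-formedness of the guarded part, given the set `Y` of already bound
`y`-variables: the bound variables `y₁, …, y_ℓ` are pairwise distinct (and, being
indexed separately from the guards `x₁, …, x_k`, disjoint from them), and the
quantifier-free core has its free variables among `y₁, …, y_ℓ`. -/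
def Guarded.WF {AP : Type} {k : ℕ} : Set ℕ → Guarded AP k → Prop
  | Y, base ψ => ψ.free ⊆ Y
  | Y, exG y _ χ => y ∉ Y ∧ χ.WF (insert y Y)
  | Y, allG y _ χ => y ∉ Y ∧ χ.WF (insert y Y)

/-- A HyperFO sentence `Q₁^M x₁. ⋯ Q_k^M x_k. Q₁^G y₁ ≥ x_{g₁}. ⋯ Q_ℓ^G y_ℓ ≥ x_{g_ℓ}. ψ`:
`k` initial-position quantifiers (`Q i = true` meaning `∃^M`, `false` meaning `∀^M`)
binding the guards `x₁, …, x_k`, followed by a guarded part. -/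
structure HyperFO (AP : Type) : Type where
  k : ℕ
  Q : Fin k → Bool
  body : Guarded AP k

/-- A HyperFO sentence is well-formed if its guarded part is. -/
def HyperFO.WF {AP : Type} (φ : HyperFO AP) : Prop := φ.body.WF ∅

/-- Semantics of a block of initial-position quantifiers over `M(T)`: `∃^M x.θ`
(resp. `∀^M x.θ`) ranges over the minimal elements `(t, 0)`, `t ∈ T`, of `M(T)`,
i.e., over the traces of `T`. -/
def MPrefixSat {AP : Type} (T : Set (Trace AP)) :
    (k : ℕ) → (Fin k → Bool) → ((Fin k → Trace AP) → Prop) → Prop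
  | 0, _, P => P (fun i => i.elim0)
  | k + 1, Q, P =>
      if Q 0 then
        ∃ t ∈ T, MPrefixSat T k (fun i => Q i.succ) (fun xs => P (Fin.cons t xs))
      else
        ∀ t ∈ T, MPrefixSat T k (fun i => Q i.succ) (fun xs => P (Fin.cons t xs))

/-- `M(T) ⊨ φ` for a HyperFO sentence `φ`. -/
def HyperFO.Models {AP : Type} (T : Set (Trace AP)) (φ : HyperFO AP) : Prop :=
  MPrefixSat T φ.k φ.Q (fun xs => φ.body.sat xs (fun _ => (fun _ => ∅, 0)))

theorem QF.sat_congr {AP V : Type} (ψ : QF AP V) {ρ ρ' : V → Trace AP}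
    (h : ∀ v ∈ ψ.free, ρ v = ρ' v) : ψ.sat ρ ↔ ψ.sat ρ' := by
  induction ψ generalizing ρ ρ' with
  | atom a π => simp [QF.sat, h π rfl]
  | not ψ ih => exact not_congr (ih h)
  | or ψ₁ ψ₂ ih₁ ih₂ =>
    exact or_congr (ih₁ fun v hv => h v (Or.inl hv)) (ih₂ fun v hv => h v (Or.inr hv))
  | next ψ ih => exact ih fun v hv => funext fun n => by simp only [shiftAsgn, h v hv]
  | untl ψ₁ ψ₂ ih₁ ih₂ =>
    refine exists_congr fun j => and_congr (ih₂ fun v hv => ?_)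
      (forall₂_congr fun j' _ => ih₁ fun v hv => ?_) <;> funext n
    · simp only [shiftAsgn, h v (Or.inr hv)]
    · simp only [shiftAsgn, h v (Or.inl hv)]

theorem QF.free_nonempty {AP V : Type} (ψ : QF AP V) : ψ.free.Nonempty := by
  induction ψ with
  | atom a π => exact ⟨π, rfl⟩
  | not ψ ih => exact ih
  | or ψ₁ ψ₂ ih₁ ih₂ => exact ih₁.inl
  | next ψ ih => exact ih
  | untl ψ₁ ψ₂ ih₁ ih₂ => exact ih₁.inl

theorem shiftAsgn_shiftAsgn {AP V : Type} (ρ : V → Trace AP) (i j : ℕ) :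
    shiftAsgn (shiftAsgn ρ i) j = shiftAsgn ρ (i + j) := by
  funext v n
  simp only [shiftAsgn]
  congr 1
  omega

theorem QFF.dependsOn_sat {AP : Type} (M : QFF AP) :
    DependsOn (fun β : ℕ → Trace AP × ℕ => M.sat β) M.free := by
  intro β β' h
  induction M with
  | eq x y => simp [QFF.sat, h x (by simp [QFF.free]), h y (by simp [QFF.free])]
  | lt x y => simp [QFF.sat, h x (by simp [QFF.free]), h y (by simp [QFF.free])]
  | el x y => simp [QFF.sat, h x (by simp [QFF.free]), h y (by simp [QFF.free])]
  | prop a x => simp [QFF.sat, h x (by simp [QFF.free])]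
  | not ψ ih => exact congrArg Not (ih h)
  | or ψ₁ ψ₂ ih₁ ih₂ =>
    exact congrArg₂ Or (ih₁ fun v hv => h v (Or.inl hv)) (ih₂ fun v hv => h v (Or.inr hv))

/-- Trace assignment reading the variable `v` from `xs` where `f` is defined, and from `ρ`
elsewhere. -/
def partialAsgn {AP V : Type} {k : ℕ} (f : V → Option (Fin k)) (xs : Fin k → Trace AP)
    (ρ : V → Trace AP) : V → Trace AP :=
  fun v => (f v).elim (ρ v) xs

/-- The index map after adding an outermost quantifier over `π`. -/
def consIndex {V : Type} [DecidableEq V] {k : ℕ} (π : V) (f : V → Option (Fin k)) :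
    V → Option (Fin (k + 1)) :=
  fun v => (f v).elim (if v = π then some 0 else none) fun i => some i.succ

theorem partialAsgn_consIndex {AP V : Type} [DecidableEq V] {k : ℕ} (π : V)
    (f : V → Option (Fin k)) (t : Trace AP) (xs : Fin k → Trace AP) (ρ : V → Trace AP) :
    partialAsgn (consIndex π f) (Fin.cons t xs : Fin (k + 1) → Trace AP) ρ =
      partialAsgn f xs (Function.update ρ π t) := by
  funext v
  unfold partialAsgn consIndex
  cases hf : f v with
  | none => by_cases hv : v = π <;> simp [hv]
  | some i => simp

theorem consIndex_ne_none {V : Type} [DecidableEq V] {k : ℕ} {π v : V}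
    {f : V → Option (Fin k)} (h : v = π ∨ f v ≠ none) : consIndex π f v ≠ none := by
  unfold consIndex
  cases hf : f v with
  | none => simp_all
  | some i => simp

theorem HyperLTL.exists_prenex {AP V : Type} [DecidableEq V] (φ : HyperLTL AP V) :
    ∃ (k : ℕ) (Q : Fin k → Bool) (f : V → Option (Fin k)) (ψ : QF AP V),
      (∀ v ∈ ψ.free, v ∈ φ.free ∨ f v ≠ none) ∧
      ∀ (T : Set (Trace AP)) (ρ : V → Trace AP),
        φ.sat T ρ ↔ MPrefixSat T k Q fun xs => ψ.sat (partialAsgn f xs ρ) := by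
  induction φ with
  | exi π φ ih =>
    obtain ⟨k, Q, f, ψ, hfree, hsat⟩ := ih
    refine ⟨k + 1, Fin.cons true Q, consIndex π f, ψ, fun v hv => ?_, fun T ρ => ?_⟩
    · by_cases hvπ : v = π
      · exact Or.inr (consIndex_ne_none (Or.inl hvπ))
      · exact (hfree v hv).imp (fun h => ⟨h, hvπ⟩) fun h => consIndex_ne_none (Or.inr h)
    · simp [HyperLTL.sat, MPrefixSat, partialAsgn_consIndex, hsat]
  | all π φ ih =>
    obtain ⟨k, Q, f, ψ, hfree, hsat⟩ := ih
    refine ⟨k + 1, Fin.cons false Q, consIndex π f, ψ, fun v hv => ?_, fun T ρ => ?_⟩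
    · by_cases hvπ : v = π
      · exact Or.inr (consIndex_ne_none (Or.inl hvπ))
      · exact (hfree v hv).imp (fun h => ⟨h, hvπ⟩) fun h => consIndex_ne_none (Or.inr h)
    · simp [HyperLTL.sat, MPrefixSat, partialAsgn_consIndex, hsat]
  | qf ψ =>
    exact ⟨0, Fin.elim0, fun _ => none, ψ, fun v hv => Or.inl hv, fun T ρ => Iff.rfl⟩

/-- The guarded formula whose quantifiers are listed in `l` (`true` for `∃`), binding the
consecutive variables `N, N + 1, …`, with matrix `M`. -/
def Guarded.block {AP : Type} {k : ℕ} (M : QFF AP) : List (Bool × Fin k) → ℕ → Guarded AP k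
  | [], _ => .base M
  | (true, g) :: l, N => .exG N g (Guarded.block M l (N + 1))
  | (false, g) :: l, N => .allG N g (Guarded.block M l (N + 1))

/-- Semantics of a block of guarded quantifiers binding `N, N + 1, …` in front of an arbitrary
predicate on valuations. -/
def BlockSat {AP : Type} {k : ℕ} (xs : Fin k → Trace AP) (P : (ℕ → Trace AP × ℕ) → Prop) :
    List (Bool × Fin k) → ℕ → (ℕ → Trace AP × ℕ) → Prop
  | [], _, β => P β
  | (true, g) :: l, N, β => ∃ n, BlockSat xs P l (N + 1) (Function.update β N (xs g, n))
  | (false, g) :: l, N, β => ∀ n, BlockSat xs P l (N + 1) (Function.update β N (xs g, n))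

theorem Guarded.sat_block {AP : Type} {k : ℕ} (xs : Fin k → Trace AP) (M : QFF AP)
    (l : List (Bool × Fin k)) (N : ℕ) (β : ℕ → Trace AP × ℕ) :
    (Guarded.block M l N).sat xs β ↔ BlockSat xs (fun β => M.sat β) l N β := by
  induction l generalizing N β with
  | nil => rfl
  | cons q l ih =>
    obtain ⟨b, g⟩ := q
    cases b
    · exact forall_congr' fun n => ih _ _
    · exact exists_congr fun n => ih _ _

theorem Set.insert_union_Ico_succ (S : Set ℕ) (N L : ℕ) :
    insert N S ∪ Set.Ico (N + 1) (N + 1 + L) = S ∪ Set.Ico N (N + (L + 1)) := by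
  ext x
  simp only [Set.mem_union, Set.mem_insert_iff, Set.mem_Ico]
  by_cases hx : x ∈ S
  · simp [hx]
  · simp only [hx, or_false, false_or]
    omega

theorem Guarded.wf_block {AP : Type} {k : ℕ} (M : QFF AP) (l : List (Bool × Fin k)) (N : ℕ)
    {S : Set ℕ} (hS : S ⊆ Set.Iio N) (hM : M.free ⊆ S ∪ Set.Ico N (N + l.length)) :
    (Guarded.block M l N).WF S := by
  induction l generalizing N S with
  | nil => simpa [Guarded.block, Guarded.WF] using hM
  | cons q l ih =>
    obtain ⟨b, g⟩ := q
    have hrec : (Guarded.block M l (N + 1)).WF (insert N S) := by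
      refine ih (N + 1) (Set.insert_subset (Nat.lt_succ_self N) fun x hx => ?_) ?_
      · exact Nat.lt_succ_of_lt (hS hx)
      · rwa [Set.insert_union_Ico_succ]
    have hN : N ∉ S := fun h => lt_irrefl N (hS h)
    cases b <;> exact ⟨hN, hrec⟩

section BlockSat

variable {AP : Type} {k : ℕ} (xs : Fin k → Trace AP) {P Q : (ℕ → Trace AP × ℕ) → Prop}

theorem BlockSat.append (l₁ l₂ : List (Bool × Fin k)) (N : ℕ) (β : ℕ → Trace AP × ℕ) :
    BlockSat xs P (l₁ ++ l₂) N β ↔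
      BlockSat xs (BlockSat xs P l₂ (N + l₁.length)) l₁ N β := by
  induction l₁ generalizing N β with
  | nil => rfl
  | cons q l ih =>
    have hN : N + (q :: l).length = N + 1 + l.length := by simp only [List.length_cons]; omega
    rw [hN]
    obtain ⟨b, g⟩ := q
    cases b
    · exact forall_congr' fun n => ih _ _
    · exact exists_congr fun n => ih _ _

theorem BlockSat.not (l : List (Bool × Fin k)) (N : ℕ) (β : ℕ → Trace AP × ℕ) :
    BlockSat xs (fun β => ¬ P β) (l.map fun q => (!q.1, q.2)) N β ↔ ¬ BlockSat xs P l N β := by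
  induction l generalizing N β with
  | nil => rfl
  | cons q l ih =>
    obtain ⟨b, g⟩ := q
    cases b
    · exact (exists_congr fun n => ih _ _).trans not_forall.symm
    · exact (forall_congr' fun n => ih _ _).trans not_exists.symm

theorem BlockSat.or_right {N₀ : ℕ} (hQ : ∀ N β v, N₀ ≤ N → (Q (Function.update β N v) ↔ Q β))
    (l : List (Bool × Fin k)) (N : ℕ) (hN : N₀ ≤ N) (β : ℕ → Trace AP × ℕ) :
    BlockSat xs (fun β => P β ∨ Q β) l N β ↔ BlockSat xs P l N β ∨ Q β := by
  induction l generalizing N β with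
  | nil => rfl
  | cons q l ih =>
    obtain ⟨b, g⟩ := q
    cases b
    · refine (forall_congr' fun n => ?_).trans forall_or_right
      rw [ih _ (by omega), hQ _ _ _ hN]
    · refine (exists_congr fun n => ?_).trans (exists_or.trans (or_congr_right (exists_const ℕ)))
      rw [ih _ (by omega), hQ _ _ _ hN]

theorem BlockSat.dependsOn (l : List (Bool × Fin k)) (N : ℕ) {S : Set ℕ}
    (hP : DependsOn P (S ∪ Set.Ico N (N + l.length))) :
    DependsOn (BlockSat xs P l N) S := by
  induction l generalizing N S with
  | nil => exact hP.mono (by simp)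
  | cons q l ih =>
    intro β β' h
    have hrec := ih (N + 1) (S := insert N S) (by rwa [Set.insert_union_Ico_succ])
    have hupd (v : Trace AP × ℕ) : BlockSat xs P l (N + 1) (Function.update β N v) =
        BlockSat xs P l (N + 1) (Function.update β' N v) := by
      refine hrec fun i hi => ?_
      by_cases hiN : i = N
      · simp [hiN]
      · simpa [hiN] using h i (hi.resolve_left hiN)
    obtain ⟨b, g⟩ := q
    cases b <;> simp only [BlockSat, hupd]

end BlockSat

theorem DependsOn.update_iff {α : Type} {Q : (ℕ → α) → Prop} {S : Set ℕ} (hQ : DependsOn Q S)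
    {N₀ : ℕ} (hS : S ⊆ Set.Iio N₀) (N : ℕ) (β : ℕ → α) (v : α) (hN : N₀ ≤ N) :
    Q (Function.update β N v) ↔ Q β := by
  refine iff_of_eq (hQ fun i hi => Function.update_of_ne ?_ _ _)
  have : i < N₀ := hS hi
  omega

/-- `R`, a predicate on traces and on the time points assigned to the variables in `S`, is
expressed by a prenex guarded formula, using bound variables from any `N` above `S` onward,
provided the variables in `S` denote positions of the first trace. -/
def GuardedDefinable {AP : Type} {k : ℕ} (S : Set ℕ)
    (R : (Fin (k + 1) → Trace AP) → (ℕ → ℕ) → Prop) : Prop :=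
  ∀ N : ℕ, S ⊆ Set.Iio N → ∃ (l : List (Bool × Fin (k + 1))) (M : QFF AP),
    M.free ⊆ S ∪ Set.Ico N (N + l.length) ∧
    ∀ (xs : Fin (k + 1) → Trace AP) (β : ℕ → Trace AP × ℕ), (∀ s ∈ S, (β s).1 = xs 0) →
      (BlockSat xs (fun β => M.sat β) l N β ↔ R xs fun v => (β v).2)

namespace GuardedDefinable

variable {AP : Type} {k : ℕ} {S S' : Set ℕ} {R R' : (Fin (k + 1) → Trace AP) → (ℕ → ℕ) → Prop}

theorem mono (h : GuardedDefinable S R) (hS : S ⊆ S') : GuardedDefinable S' R := by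
  intro N hN
  obtain ⟨l, M, hM, hsat⟩ := h N (hS.trans hN)
  exact ⟨l, M, hM.trans (Set.union_subset_union_left _ hS),
    fun xs β hβ => hsat xs β fun s hs => hβ s (hS hs)⟩

theorem lt {y z : ℕ} (hy : y ∈ S) (hz : z ∈ S) :
    GuardedDefinable S fun (_ : Fin (k + 1) → Trace AP) τ => τ y < τ z := by
  intro N hN
  refine ⟨[], .lt y z, ?_, fun xs β hβ => ?_⟩
  · rintro x (rfl | rfl)
    exacts [Or.inl hy, Or.inl hz]
  · simp [BlockSat, QFF.sat, hβ y hy, hβ z hz]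

theorem prop (a : AP) (i : Fin (k + 1)) {y : ℕ} (hy : y ∈ S) :
    GuardedDefinable S fun xs τ => a ∈ xs i (τ y) := by
  intro N hN
  have hyN : y ≠ N := (hN hy).ne
  refine ⟨[(true, i)], .not (.or (.not (.el N y)) (.not (.prop a N))), ?_, fun xs β hβ => ?_⟩
  · intro x hx
    simp only [QFF.free, Set.mem_union, Set.mem_insert_iff, Set.mem_singleton_iff] at hx
    rcases hx with (rfl | rfl) | rfl
    · exact Or.inr (by simp)
    · exact Or.inl hy
    · exact Or.inr (by simp)
  · simp [BlockSat, QFF.sat, hyN]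

theorem not (h : GuardedDefinable S R) : GuardedDefinable S fun xs τ => ¬ R xs τ := by
  intro N hN
  obtain ⟨l, M, hM, hsat⟩ := h N hN
  refine ⟨l.map fun q => (!q.1, q.2), .not M, by simpa [QFF.free] using hM,
    fun xs β hβ => ?_⟩
  exact (BlockSat.not xs l N β).trans (not_congr (hsat xs β hβ))

theorem or (h : GuardedDefinable S R) (h' : GuardedDefinable S R') :
    GuardedDefinable S fun xs τ => R xs τ ∨ R' xs τ := by
  intro N hN
  obtain ⟨l₁, M₁, hM₁, hsat₁⟩ := h N hN
  obtain ⟨l₂, M₂, hM₂, hsat₂⟩ :=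
    h' (N + l₁.length) (hN.trans (Set.Iio_subset_Iio (by omega)))
  have hfree₁ : M₁.free ⊆ Set.Iio (N + l₁.length) := fun x hx => by
    rcases hM₁ hx with hx | hx
    · exact (show x < N from hN hx).trans_le (by omega)
    · exact hx.2
  refine ⟨l₁ ++ l₂, .or M₂ M₁, ?_, fun xs β hβ => ?_⟩
  · rintro x (hx | hx)
    · refine (hM₂ hx).imp_right fun hx => ?_
      simp only [Set.mem_Ico, List.length_append] at hx ⊢
      omega
    · refine (hM₁ hx).imp_right fun hx => ?_
      simp only [Set.mem_Ico, List.length_append] at hx ⊢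
      omega
  · have hinner : BlockSat xs (fun β => (QFF.or M₂ M₁).sat β) l₂ (N + l₁.length) =
        fun β => M₁.sat β ∨ BlockSat xs (fun β => M₂.sat β) l₂ (N + l₁.length) β := by
      funext β
      rw [or_comm]
      exact propext (BlockSat.or_right xs (M₁.dependsOn_sat.update_iff hfree₁) l₂ _ le_rfl β)
    have hdep : DependsOn (BlockSat xs (fun β => M₂.sat β) l₂ (N + l₁.length)) S :=
      BlockSat.dependsOn xs l₂ _ (M₂.dependsOn_sat.mono hM₂)
    rw [BlockSat.append, hinner, BlockSat.or_right xs (hdep.update_iff hN) l₁ N le_rfl β,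
      hsat₁ xs β hβ, hsat₂ xs β hβ]

theorem and (h : GuardedDefinable S R) (h' : GuardedDefinable S R') :
    GuardedDefinable S fun xs τ => R xs τ ∧ R' xs τ := by
  simpa only [not_or, not_not] using (h.not.or h'.not).not

theorem le {y z : ℕ} (hy : y ∈ S) (hz : z ∈ S) :
    GuardedDefinable S fun (_ : Fin (k + 1) → Trace AP) τ => τ y ≤ τ z := by
  simpa only [not_lt] using (lt (AP := AP) (k := k) hz hy).not

theorem ex {R : (Fin (k + 1) → Trace AP) → (ℕ → ℕ) → ℕ → Prop}
    (hR : ∀ xs n, DependsOn (fun τ => R xs τ n) S)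
    (h : ∀ z ∉ S, GuardedDefinable (insert z S) fun xs τ => R xs τ (τ z)) :
    GuardedDefinable S fun xs τ => ∃ n, R xs τ n := by
  intro N hN
  have hNS : N ∉ S := fun h => lt_irrefl N (hN h)
  obtain ⟨l, M, hM, hsat⟩ := h N hNS (N + 1)
    (Set.insert_subset (Nat.lt_succ_self N) fun x hx => Nat.lt_succ_of_lt (hN hx))
  refine ⟨(true, 0) :: l, M, by rwa [Set.insert_union_Ico_succ] at hM, fun xs β hβ => ?_⟩
  refine exists_congr fun n => ?_
  have hne {s : ℕ} (hs : s ∈ S) : s ≠ N := fun h => hNS (h ▸ hs)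
  rw [hsat]
  · simp only [Function.update_self]
    exact iff_of_eq (hR xs n fun s hs => by simp [hne hs])
  · rintro s (rfl | hs)
    · simp
    · simp [hne hs, hβ s hs]

end GuardedDefinable

theorem QF.sat_next_shift_iff {AP V : Type} (ψ : QF AP V) (ρ : V → Trace AP) (i : ℕ) :
    (QF.next ψ).sat (shiftAsgn ρ i) ↔
      ∃ j, (i < j ∧ ¬ ∃ j', i < j' ∧ j' < j) ∧ ψ.sat (shiftAsgn ρ j) := by
  rw [QF.sat, shiftAsgn_shiftAsgn]
  constructor
  · exact fun h => ⟨i + 1, ⟨by omega, fun ⟨j', h₁, h₂⟩ => by omega⟩, h⟩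
  · rintro ⟨j, ⟨hij, hj⟩, h⟩
    obtain rfl : j = i + 1 := by
      by_contra hne
      exact hj ⟨i + 1, by omega, by omega⟩
    exact h

theorem QF.sat_untl_shift_iff {AP V : Type} (ψ₁ ψ₂ : QF AP V) (ρ : V → Trace AP) (i : ℕ) :
    (QF.untl ψ₁ ψ₂).sat (shiftAsgn ρ i) ↔
      ∃ j, (i ≤ j ∧ ψ₂.sat (shiftAsgn ρ j)) ∧
        ¬ ∃ j', (i ≤ j' ∧ j' < j) ∧ ¬ ψ₁.sat (shiftAsgn ρ j') := by
  simp only [QF.sat, shiftAsgn_shiftAsgn]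
  constructor
  · rintro ⟨j, h₂, h₁⟩
    refine ⟨i + j, ⟨by omega, h₂⟩, fun ⟨j', ⟨hij, hj⟩, hn⟩ => hn ?_⟩
    obtain ⟨d, rfl⟩ := Nat.exists_eq_add_of_le hij
    exact h₁ d (by omega)
  · rintro ⟨j, ⟨hij, h₂⟩, h₁⟩
    obtain ⟨d, rfl⟩ := Nat.exists_eq_add_of_le hij
    refine ⟨d, h₂, fun j' hj' => ?_⟩
    by_contra hn
    exact h₁ ⟨i + j', ⟨by omega, by omega⟩, hn⟩

theorem QF.guardedDefinable_sat {AP V : Type} {k : ℕ} (f : V → Fin (k + 1)) (ψ : QF AP V)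
    (y : ℕ) :
    GuardedDefinable {y} fun (xs : Fin (k + 1) → Trace AP) τ =>
      ψ.sat (shiftAsgn (fun v => xs (f v)) (τ y)) := by
  induction ψ generalizing y with
  | atom a π =>
    simpa only [QF.sat, shiftAsgn, zero_add] using
      GuardedDefinable.prop (S := {y}) a (f π) rfl
  | not ψ ih => exact (ih y).not
  | or ψ₁ ψ₂ ih₁ ih₂ => exact (ih₁ y).or (ih₂ y)
  | next ψ ih =>
    simp only [QF.sat_next_shift_iff]
    refine .ex (fun xs n τ τ' h => by simp only [h y rfl]) fun z _ => ?_
    refine .and (.and (.lt (by simp) (by simp)) (.not ?_)) ((ih z).mono (by simp))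
    refine .ex (fun xs n τ τ' h => by simp only [h y (by simp), h z (by simp)]) fun w _ => ?_
    exact .and (.lt (by simp) (by simp)) (.lt (by simp) (by simp))
  | untl ψ₁ ψ₂ ih₁ ih₂ =>
    simp only [QF.sat_untl_shift_iff]
    refine .ex (fun xs n τ τ' h => by simp only [h y rfl]) fun z _ => ?_
    refine .and (.and (.le (by simp) (by simp)) ((ih₂ z).mono (by simp))) (.not ?_)
    refine .ex (fun xs n τ τ' h => by simp only [h y (by simp), h z (by simp)]) fun w _ => ?_
    exact .and (.and (.le (by simp) (by simp)) (.lt (by simp) (by simp)))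
      ((ih₁ w).mono (by simp)).not

theorem QF.guardedDefinable_sat_zero {AP V : Type} {k : ℕ} (f : V → Fin (k + 1))
    (ψ : QF AP V) :
    GuardedDefinable ∅ fun (xs : Fin (k + 1) → Trace AP) _ => ψ.sat fun v => xs (f v) := by
  have hinit (ρ : V → Trace AP) :
      ψ.sat ρ ↔ ∃ n, (¬ ∃ m, m < n) ∧ ψ.sat (shiftAsgn ρ n) := by
    constructor
    · exact fun h => ⟨0, by simp, h⟩
    · rintro ⟨n, hn, h⟩
      obtain rfl : n = 0 := by
        by_contra hne
        exact hn ⟨0, by omega⟩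
      exact h
  suffices GuardedDefinable ∅ fun (xs : Fin (k + 1) → Trace AP) _ =>
      ∃ n, (¬ ∃ m, m < n) ∧ ψ.sat (shiftAsgn (fun v => xs (f v)) n) by
    simpa only [← hinit] using this
  refine .ex (fun xs n τ τ' _ => rfl) fun z _ => ?_
  refine .and (.not ?_) ((ψ.guardedDefinable_sat f z).mono (by simp))
  exact .ex (fun xs n τ τ' h => by simp only [h z (by simp)]) fun w _ =>
    .lt (by simp) (by simp)

/-- For every HyperLTL sentence `φ` there is a HyperFO sentence `φ'`
such that for every set `T` of traces: `T ⊨ φ` iff `M(T) ⊨ φ'`. -/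
theorem hyperltl_to_hyperfo {AP : Type} [Finite AP] (φ : HyperLTL AP ℕ)
    (hφ : φ.Closed) :
    ∃ φ' : HyperFO AP, φ'.WF ∧
      ∀ T : Set (Trace AP), HyperLTL.Models T φ ↔ HyperFO.Models T φ' := by
  obtain ⟨k, Q, f, ψ, hfree, hsat⟩ := φ.exists_prenex
  have hdef (v : ℕ) (hv : v ∈ ψ.free) : f v ≠ none :=
    (hfree v hv).resolve_left fun h => by simp [show φ.free = ∅ from hφ] at h
  obtain ⟨v₀, hv₀⟩ := ψ.free_nonempty
  obtain ⟨i₀, -⟩ := Option.ne_none_iff_exists.mp (hdef v₀ hv₀)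
  obtain ⟨k, rfl⟩ : ∃ k', k = k' + 1 := Nat.exists_eq_succ_of_ne_zero (i₀.pos).ne'
  obtain ⟨l, M, hM, hbody⟩ :=
    ψ.guardedDefinable_sat_zero (fun v => (f v).getD 0) 0 (Set.empty_subset _)
  refine ⟨⟨k + 1, Q, Guarded.block M l 0⟩,
    Guarded.wf_block M l 0 (Set.empty_subset _) hM, fun T => ?_⟩
  unfold HyperLTL.Models HyperFO.Models
  rw [hsat]
  refine iff_of_eq (congrArg (MPrefixSat T (k + 1) Q) (funext fun xs => propext ?_))
  rw [Guarded.sat_block, hbody xs _ (by simp)]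
  refine ψ.sat_congr fun v hv => ?_
  obtain ⟨i, hi⟩ := Option.ne_none_iff_exists.mp (hdef v hv)
  simp [partialAsgn, ← hi]
end
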